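/- Let n > 1, let σ be a permutation of Fin (2n) that is a single cycle of length 2n, and let ρ be a fixed-point-free involution of Fin (2n) such that ρ ∘ σ has exactly n + 1 orbits on Fin (2n). Let f be a fixed point of ρ ∘ σ (so that ρ swaps f and σ f, and the set M = Fin (2n) \ {f, σ f} is invariant under ρ). Define permutations of M by ρ̂(k) = ρ(k), and σ̂(k) = σ³(k) if σ(k) = f and σ̂(k) = σ(k) otherwise. Then ρ̂ ∘ σ̂ has exactly n orbits on M. -/

import Mathlib

/-- Number of orbits of the cyclic group generated by a permutation `π`
(fixed points are counted as orbits of size 1). -/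
noncomputable def numOrbits {α : Type*} (π : Equiv.Perm α) : ℕ :=
  Nat.card (MulAction.orbitRel.Quotient (Subgroup.zpowers π) α)

theorem numOrbits_eq_aux {α : Type*} (π : Equiv.Perm α) :
    numOrbits π = Nat.card (Quotient (Equiv.Perm.SameCycle.setoid π)) := by
  have h : MulAction.orbitRel (Subgroup.zpowers π) α = Equiv.Perm.SameCycle.setoid π := by
    ext x y
    rw [MulAction.orbitRel_apply, MulAction.mem_orbit_iff]
    change _ ↔ π.SameCycle x y
    constructor
    · rintro ⟨⟨_, k, rfl⟩, hk⟩
      exact Equiv.Perm.SameCycle.symm ⟨k, hk⟩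
    · intro h
      obtain ⟨k, hk⟩ := h.symm
      exact ⟨⟨π ^ k, k, rfl⟩, hk⟩
  unfold numOrbits MulAction.orbitRel.Quotient
  rw [h]

theorem sameCycle_map_aux {α β : Type*} (π : Equiv.Perm α) (τ : Equiv.Perm β) (F : α → β)
    (hF : ∀ x, τ.SameCycle (F x) (F (π x))) {x y : α} (h : π.SameCycle x y) :
    τ.SameCycle (F x) (F y) := by
  obtain ⟨k, rfl⟩ := h
  induction k using Int.induction_on with
  | zero => exact Equiv.Perm.SameCycle.refl _ _
  | succ k ih =>
    have := hF ((π ^ (k : ℤ)) x)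
    rw [← Equiv.Perm.mul_apply, ← zpow_one_add, add_comm] at this
    exact ih.trans this
  | pred k ih =>
    have := hF ((π ^ (-(k : ℤ) - 1)) x)
    rw [← Equiv.Perm.mul_apply, ← zpow_one_add, add_sub_cancel] at this
    exact ih.trans this.symm

theorem stmt2 (n : ℕ) (hn : 1 < n) (σ ρ : Equiv.Perm (Fin (2 * n)))
    (hσ : σ.IsCycle) (hσlen : σ.support.card = 2 * n)
    (hρ2 : ρ * ρ = 1) (hρfix : ∀ m, ρ m ≠ m)
    (horb : numOrbits (ρ * σ) = n + 1)
    (f : Fin (2 * n)) (hf : ρ (σ f) = f)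
    (ρhat σhat : Equiv.Perm {x : Fin (2 * n) // x ≠ f ∧ x ≠ σ f})
    (hρhat : ∀ x, (ρhat x : Fin (2 * n)) = ρ (x : Fin (2 * n)))
    (hσhat : ∀ x, (σhat x : Fin (2 * n)) =
      if σ (x : Fin (2 * n)) = f then (σ ^ 3) (x : Fin (2 * n))
      else σ (x : Fin (2 * n))) :
    numOrbits (ρhat * σhat) = n := by
  have hgg : σ (σ f) ≠ f := by
    intro h
    have h2 : (σ ^ 2) f = f := by simpa [pow_two] using h
    have hfs : σ f ≠ f := by
      intro h'
      rw [h'] at hf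
      exact hρfix f hf
    have h3 : σ ^ 2 = 1 := (hσ.pow_eq_one_iff).2 ⟨f, hfs, h2⟩
    have h4 := orderOf_dvd_of_pow_eq_one h3
    rw [hσ.orderOf, hσlen] at h4
    have := Nat.le_of_dvd (by norm_num) h4
    omega
  have hρρ : ∀ x, ρ (ρ x) = x := fun x => by
    rw [← Equiv.Perm.mul_apply, hρ2]; rfl
  have hρf : ρ f = σ f := by
    conv_lhs => rw [← hf]
    exact hρρ _
  have hgf : σ f ≠ f := fun h => hρfix f (by rw [hρf, h])
  obtain ⟨p, hp⟩ := σ.surjective f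
  have hpf : p ≠ f := by rintro rfl; exact hgf hp
  have hpg : p ≠ σ f := by rintro rfl; exact hgg hp
  set π := ρ * σ with hπ
  set τ := ρhat * σhat with hτ
  have hπf : π f = f := hf
  have hπp : π p = σ f := by simp [hπ, hp, hρf]
  let P : {x : Fin (2 * n) // x ≠ f ∧ x ≠ σ f} := ⟨p, hpf, hpg⟩
  have hτp : ((τ P : _) : Fin (2 * n)) = π (σ f) := by
    simp [hτ, hπ, hρhat, hσhat, P, hp, pow_succ]
  have hτx : ∀ x : {x : Fin (2 * n) // x ≠ f ∧ x ≠ σ f}, (x : Fin (2 * n)) ≠ p → ((τ x : _) : Fin (2 * n)) = π x := by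
    intro x hx
    have : σ x ≠ f := fun h => hx (σ.injective (h.trans hp.symm))
    simp [hτ, hπ, hρhat, hσhat, this]
  have h1 : ∀ {x y}, τ.SameCycle x y → π.SameCycle (x : Fin (2 * n)) y := by
    intro x y h
    refine sameCycle_map_aux τ π Subtype.val ?_ h
    intro x
    by_cases hx : (x : Fin (2 * n)) = p
    · obtain rfl : x = P := Subtype.ext hx
      rw [hτp]
      exact ⟨2, by simp [P, zpow_ofNat, pow_two, hπp]⟩
    · rw [hτx x hx]
      exact ⟨1, by simp⟩
  have h2 : ∀ {x y : {x : Fin (2 * n) // x ≠ f ∧ x ≠ σ f}},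
      π.SameCycle (x : Fin (2 * n)) y → τ.SameCycle x y := by
    intro x y h
    let F : Fin (2 * n) → {x : Fin (2 * n) // x ≠ f ∧ x ≠ σ f} := fun x =>
      if h : x ≠ f ∧ x ≠ σ f then ⟨x, h⟩ else P
    have hFx : ∀ x : {x : Fin (2 * n) // x ≠ f ∧ x ≠ σ f}, F x = x := by
      intro x
      simp only [F, dif_pos x.2]
    have hFg : F (σ f) = P := by simp [F]
    have := sameCycle_map_aux π τ F ?_ h
    · rwa [hFx, hFx] at this
    · intro x
      by_cases hxf : x = f
      · rw [hxf, hπf]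
      by_cases hxg : x = σ f
      · rw [hxg, hFg, ← hτp, hFx]
        exact ⟨1, by simp⟩
      by_cases hxp : x = p
      · rw [hxp, hπp, hFg, show F p = P from hFx P]
      · have e := hτx ⟨x, hxf, hxg⟩ hxp
        rw [show F x = ⟨x, hxf, hxg⟩ from hFx ⟨x, hxf, hxg⟩]
        change _ = π x at e
        rw [← e, hFx]
        exact ⟨1, by simp⟩
  have h3 : ∀ x, π.SameCycle f x → x = f := by
    rintro x ⟨k, rfl⟩
    exact Equiv.Perm.zpow_apply_eq_self_of_apply_eq_self hπf k
  rw [numOrbits_eq_aux] at horb ⊢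
  let φ : Option (Quotient (Equiv.Perm.SameCycle.setoid τ)) →
      Quotient (Equiv.Perm.SameCycle.setoid π) := fun o =>
    o.elim (Quotient.mk _ f) (Quotient.map Subtype.val (fun _ _ h => h1 h))
  have hφ : Function.Bijective φ := by
    constructor
    · rintro (_ | ⟨⟨x⟩⟩) (_ | ⟨⟨y⟩⟩) h
      · rfl
      · have h := h3 _ (Quotient.exact h)
        exact absurd h y.2.1
      · have h := h3 _ (Quotient.exact h.symm)
        exact absurd h x.2.1
      · exact congrArg some (Quotient.sound (h2 (Quotient.exact h)))
    · rintro ⟨x⟩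
      by_cases hxf : x = f
      · exact ⟨none, by rw [hxf]; rfl⟩
      by_cases hxg : x = σ f
      · refine ⟨some (Quotient.mk _ P), ?_⟩
        exact Quotient.sound (show π.SameCycle p x from ⟨1, by simp [hπp, hxg]⟩)
      · exact ⟨some (Quotient.mk _ ⟨x, hxf, hxg⟩), rfl⟩
  have hc := Nat.card_eq_of_bijective φ hφ
  rw [horb, Finite.card_option] at hc
  omega
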